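/- arXiv:0910.4566 — 2 statements merged into one kernel-verified Lean document; each statement's English description precedes it below -/
import Mathlib

section
/- In the hyperbolic plane, let X be a point, γ a geodesic with dist(X, γ) < ε, and let s be a geodesic segment of length at least a starting at X such that the angle at X between s and the perpendicular segment from X to γ is at most φ/2, where ε is chosen so that a hyperbolic right triangle with hypotenuse of length a and an acute angle φ/2 has the leg adjacent to that angle equal to ε. Then the segment s intersects γ. -/
open UpperHalfPlane Set Filter


/-- A complete unit-speed geodesic of the hyperbolic plane. -/
def IsGeodesicLine (γ : ℝ → ℍ) : Prop :=
  ∀ s t : ℝ, dist (γ s) (γ t) = |s - t|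

/-- A unit-speed geodesic segment defined on `[0, L]`. -/
def IsGeodesicSegmentOn (σ : ℝ → ℍ) (L : ℝ) : Prop :=
  ∀ s ∈ Set.Icc (0 : ℝ) L, ∀ t ∈ Set.Icc (0 : ℝ) L, dist (σ s) (σ t) = |s - t|

/-- The angle `θ` between two unit-speed geodesic segments emanating from a
common point, defined by Euclidean comparison:
`θ = lim_{t → 0⁺} 2 arcsin (dist (σ t) (τ t) / (2t))`. -/
def AngleBetween (σ τ : ℝ → ℍ) (θ : ℝ) : Prop :=
  Tendsto (fun t : ℝ => 2 * Real.arcsin (dist (σ t) (τ t) / (2 * t)))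
    (nhdsWithin 0 (Set.Ioi 0)) (nhds θ)

/-- The upper half-plane embedded as the sheet `a * c - b ^ 2 = 1`, `0 < c` of a hyperboloid. -/
noncomputable def hyperboloidEmbed (z : ℍ) : ℝ × ℝ × ℝ :=
  ((z.re ^ 2 + z.im ^ 2) / z.im, z.re / z.im, 1 / z.im)

/-- The Lorentzian form of signature `(1, 2)` polarizing `a * c - b ^ 2`. -/
noncomputable def lorentzForm (u v : ℝ × ℝ × ℝ) : ℝ :=
  (u.1 * v.2.2 + v.1 * u.2.2) / 2 - u.2.1 * v.2.1

theorem lorentzForm_comm (u v : ℝ × ℝ × ℝ) : lorentzForm u v = lorentzForm v u := by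
  simp only [lorentzForm]; ring

theorem lorentzForm_add_left (u v w : ℝ × ℝ × ℝ) :
    lorentzForm (u + v) w = lorentzForm u w + lorentzForm v w := by
  simp only [lorentzForm, Prod.fst_add, Prod.snd_add]; ring

theorem lorentzForm_sub_left (u v w : ℝ × ℝ × ℝ) :
    lorentzForm (u - v) w = lorentzForm u w - lorentzForm v w := by
  simp only [lorentzForm, Prod.fst_sub, Prod.snd_sub]; ring

theorem lorentzForm_smul_left (c : ℝ) (u w : ℝ × ℝ × ℝ) :
    lorentzForm (c • u) w = c * lorentzForm u w := by
  simp only [lorentzForm, Prod.smul_fst, Prod.smul_snd, smul_eq_mul]; ring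

theorem lorentzForm_add_right (u v w : ℝ × ℝ × ℝ) :
    lorentzForm w (u + v) = lorentzForm w u + lorentzForm w v := by
  simp only [lorentzForm, Prod.fst_add, Prod.snd_add]; ring

theorem lorentzForm_sub_right (u v w : ℝ × ℝ × ℝ) :
    lorentzForm w (u - v) = lorentzForm w u - lorentzForm w v := by
  simp only [lorentzForm, Prod.fst_sub, Prod.snd_sub]; ring

theorem lorentzForm_smul_right (c : ℝ) (u w : ℝ × ℝ × ℝ) :
    lorentzForm w (c • u) = c * lorentzForm w u := by
  simp only [lorentzForm, Prod.smul_fst, Prod.smul_snd, smul_eq_mul]; ring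

theorem lorentzForm_hyperboloidEmbed (z w : ℍ) :
    lorentzForm (hyperboloidEmbed z) (hyperboloidEmbed w) = Real.cosh (dist z w) := by
  have hz := z.im_ne_zero
  have hw := w.im_ne_zero
  rw [UpperHalfPlane.cosh_dist, Complex.dist_eq, Complex.sq_norm, Complex.normSq_apply]
  simp only [lorentzForm, hyperboloidEmbed, Complex.sub_re, Complex.sub_im,
    UpperHalfPlane.coe_re, UpperHalfPlane.coe_im]
  field_simp
  ring

theorem lorentzForm_hyperboloidEmbed_self (z : ℍ) :
    lorentzForm (hyperboloidEmbed z) (hyperboloidEmbed z) = 1 := by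
  simp [lorentzForm_hyperboloidEmbed]

/-- The Lorentz form is definite on the orthogonal complement of a point of the hyperboloid. -/
theorem eq_zero_of_lorentzForm_eq_zero {u : ℝ × ℝ × ℝ} {z : ℍ}
    (hu : lorentzForm u (hyperboloidEmbed z) = 0) (huu : lorentzForm u u = 0) : u = 0 := by
  have hz := lorentzForm_hyperboloidEmbed_self z
  have hc : 0 < (hyperboloidEmbed z).2.2 := one_div_pos.2 z.im_pos
  generalize hyperboloidEmbed z = w at *
  obtain ⟨a, b, c⟩ := u
  obtain ⟨A, B, C⟩ := w
  simp only [lorentzForm] at *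
  have hac : a * c = b ^ 2 := by linarith
  have hAC : A * C = B ^ 2 + 1 := by linarith
  have hlin : a * C + A * c = 2 * b * B := by linarith
  have key : (a * C - A * c) ^ 2 + 4 * b ^ 2 = 0 := by
    linear_combination (a * C + A * c + 2 * b * B) * hlin - (4 * A * C) * hac - 4 * b ^ 2 * hAC
  have hb : b = 0 := by nlinarith [sq_nonneg (a * C - A * c), sq_nonneg b]
  have hd : a * C - A * c = 0 := by nlinarith [sq_nonneg (a * C - A * c), sq_nonneg b]
  subst hb
  have ha : a = 0 := by
    have : a * C = 0 := by linarith
    exact (mul_eq_zero.1 this).resolve_right hc.ne'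
  subst ha
  have hc0 : c = 0 := by
    have h : A * c = 0 := by linarith
    refine (mul_eq_zero.1 h).resolve_left ?_
    rintro rfl
    nlinarith [sq_nonneg B]
  subst hc0
  rfl

/-- A unit-speed geodesic is parametrized on the hyperboloid by `cosh` and `sinh`. -/
theorem exists_tangent_of_dist_eq {f : ℝ → ℍ} {S : Set ℝ}
    (hf : ∀ s ∈ S, ∀ t ∈ S, dist (f s) (f t) = |s - t|) {r l : ℝ} (hr : r ∈ S)
    (hl : l ∈ S) (hrl : r ≠ l) :
    ∃ v : ℝ × ℝ × ℝ, lorentzForm (hyperboloidEmbed (f r)) v = 0 ∧ lorentzForm v v = -1 ∧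
      ∀ t ∈ S, hyperboloidEmbed (f t) =
        Real.cosh (t - r) • hyperboloidEmbed (f r) + Real.sinh (t - r) • v := by
  have hQ : ∀ s ∈ S, ∀ t ∈ S,
      lorentzForm (hyperboloidEmbed (f s)) (hyperboloidEmbed (f t)) = Real.cosh (s - t) := by
    intro s hs t ht
    rw [lorentzForm_hyperboloidEmbed, hf s hs t ht, Real.cosh_abs]
  have hsinh : Real.sinh (l - r) ≠ 0 := by
    rw [Ne, Real.sinh_eq_zero]
    exact sub_ne_zero.2 hrl.symm
  have hsq := Real.cosh_sq (l - r)
  have hrl' : Real.cosh (r - l) = Real.cosh (l - r) := by rw [← Real.cosh_neg, neg_sub]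
  obtain ⟨v, hv⟩ : ∃ v, v = (Real.sinh (l - r))⁻¹ •
      (hyperboloidEmbed (f l) - Real.cosh (l - r) • hyperboloidEmbed (f r)) := ⟨_, rfl⟩
  have h1 : lorentzForm (hyperboloidEmbed (f r)) v = 0 := by
    rw [hv, lorentzForm_smul_right, lorentzForm_sub_right, lorentzForm_smul_right,
      hQ r hr l hl, hQ r hr r hr, hrl', sub_self, Real.cosh_zero]
    ring
  have hv_right : ∀ t ∈ S, lorentzForm (hyperboloidEmbed (f t)) v = -Real.sinh (t - r) := by
    intro t ht
    rw [hv, lorentzForm_smul_right, lorentzForm_sub_right, lorentzForm_smul_right,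
      hQ t ht l hl, hQ t ht r hr, show t - l = (t - r) - (l - r) by ring, Real.cosh_sub]
    field_simp
    ring
  have h2 : lorentzForm v v = -1 := by
    nth_rewrite 1 [hv]
    rw [lorentzForm_smul_left, lorentzForm_sub_left, lorentzForm_smul_left, h1, hv_right l hl]
    field_simp
    ring
  refine ⟨v, h1, h2, fun t ht => ?_⟩
  rw [← sub_eq_zero]
  have h3 := hQ t ht r hr
  have h4 := hv_right t ht
  have h5 := lorentzForm_hyperboloidEmbed_self (f t)
  have h6 := lorentzForm_hyperboloidEmbed_self (f r)
  apply eq_zero_of_lorentzForm_eq_zero (z := f r)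
  · simp only [lorentzForm_sub_left, lorentzForm_add_left, lorentzForm_smul_left, h3, h6,
      lorentzForm_comm v, h1]
    ring
  · simp only [lorentzForm_sub_left, lorentzForm_add_left, lorentzForm_smul_left,
      lorentzForm_sub_right, lorentzForm_add_right, lorentzForm_smul_right, h3, h4, h5, h6,
      lorentzForm_comm v, lorentzForm_comm (hyperboloidEmbed (f r)) (hyperboloidEmbed (f t)), h1, h2]
    linear_combination -Real.cosh_sq (t - r)

/-- The comparison angle of two geodesics is read off from their tangent vectors. -/
theorem lorentzForm_le_neg_cos_of_angleBetween {σ p : ℝ → ℍ} {u v w : ℝ × ℝ × ℝ}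
    {δ θ ψ : ℝ} (hδ : 0 < δ) (huu : lorentzForm u u = 1) (huv : lorentzForm u v = 0)
    (huw : lorentzForm u w = 0)
    (hσ : ∀ t ∈ Set.Icc 0 δ, hyperboloidEmbed (σ t) = Real.cosh t • u + Real.sinh t • v)
    (hp : ∀ t ∈ Set.Icc 0 δ, hyperboloidEmbed (p t) = Real.cosh t • u + Real.sinh t • w)
    (hθ : AngleBetween σ p θ) (hθψ : θ ≤ ψ) (hψ : 0 < ψ) (hψπ : ψ < Real.pi) :
    lorentzForm v w ≤ -Real.cos ψ := by
  set q := lorentzForm v w with hq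
  have hcosh : ∀ t ∈ Set.Icc 0 δ,
      Real.cosh (dist (σ t) (p t)) = 1 + Real.sinh t ^ 2 * (1 + q) := by
    intro t ht
    rw [← lorentzForm_hyperboloidEmbed, hσ t ht, hp t ht]
    simp only [lorentzForm_add_left, lorentzForm_smul_left, lorentzForm_add_right,
      lorentzForm_smul_right, huu, huw, lorentzForm_comm v u, huv, ← hq]
    linear_combination Real.cosh_sq t
  have hq1 : 0 ≤ 1 + q := by
    have h := hcosh δ ⟨hδ.le, le_rfl⟩
    have h1 := Real.one_le_cosh (dist (σ δ) (p δ))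
    have hs : 0 < Real.sinh δ ^ 2 := pow_pos (Real.sinh_pos_iff.2 hδ) 2
    by_contra! hneg
    nlinarith
  set k := Real.sqrt ((1 + q) / 2) with hk
  have hk0 : 0 ≤ k := Real.sqrt_nonneg _
  have hk2 : k ^ 2 = (1 + q) / 2 := Real.sq_sqrt (by linarith)
  have hdist : ∀ t ∈ Set.Icc 0 δ, dist (σ t) (p t) / 2 = Real.arsinh (k * Real.sinh t) := by
    intro t ht
    rw [← Real.sinh_inj, Real.sinh_arsinh]
    have h := hcosh t ht
    have h2 := Real.cosh_two_mul (dist (σ t) (p t) / 2)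
    rw [mul_div_cancel₀ _ (two_ne_zero), Real.cosh_sq, h] at h2
    refine (pow_left_inj₀ (Real.sinh_nonneg_iff.2 (by positivity))
      (mul_nonneg hk0 (Real.sinh_nonneg_iff.2 ht.1)) two_ne_zero).1 ?_
    rw [mul_pow, hk2]
    linarith
  have hderiv : HasDerivAt (fun t => Real.arsinh (k * Real.sinh t)) k 0 := by
    have h := ((Real.hasDerivAt_sinh 0).const_mul k).arsinh
    simpa using h
  have hlim : Tendsto (fun t : ℝ => dist (σ t) (p t) / (2 * t)) (nhdsWithin 0 (Set.Ioi 0))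
      (nhds k) := by
    have h := hderiv.tendsto_slope.mono_left
      (nhdsWithin_mono (0 : ℝ) (fun x (hx : x ∈ Set.Ioi 0) => ne_of_gt hx))
    refine h.congr' ?_
    filter_upwards [Ioc_mem_nhdsGT hδ] with t ht
    rw [slope_def_field, ← hdist t ⟨ht.1.le, ht.2⟩]
    simp [div_div]
  have hlim2 := ((Real.continuous_arcsin.tendsto k).comp hlim).const_mul 2
  have hθk : θ = 2 * Real.arcsin k := tendsto_nhds_unique hθ hlim2
  have hks : k ≤ Real.sin (ψ / 2) := by
    rw [← Real.arcsin_le_iff_le_sin' ⟨by linarith, by linarith⟩]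
    linarith
  have hk2le : k ^ 2 ≤ Real.sin (ψ / 2) ^ 2 := pow_le_pow_left₀ hk0 hks 2
  rw [hk2, Real.sin_sq_eq_half_sub, mul_div_cancel₀ _ (two_ne_zero)] at hk2le
  linarith

/-- If `T` is tangent to the geodesic `γ` at its point nearest to `X`, then `T` is
orthogonal to `X`. -/
theorem lorentzForm_tangent_eq_zero_of_isMin {X : ℍ} {γ : ℝ → ℍ} {s : ℝ} {T : ℝ × ℝ × ℝ}
    (hT : ∀ t, hyperboloidEmbed (γ t) =
      Real.cosh (t - s) • hyperboloidEmbed (γ s) + Real.sinh (t - s) • T)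
    (hmin : ∀ t, dist X (γ s) ≤ dist X (γ t)) :
    lorentzForm (hyperboloidEmbed X) T = 0 := by
  set c := lorentzForm (hyperboloidEmbed X) (hyperboloidEmbed (γ s))
  set b := lorentzForm (hyperboloidEmbed X) T
  have hg : ∀ t, Real.cosh (dist X (γ t)) = Real.cosh (t - s) * c + Real.sinh (t - s) * b := by
    intro t
    rw [← lorentzForm_hyperboloidEmbed, hT t, lorentzForm_add_right, lorentzForm_smul_right,
      lorentzForm_smul_right]
  have hd : HasDerivAt (fun t => Real.cosh (t - s) * c + Real.sinh (t - s) * b) b s := by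
    have h0 := (hasDerivAt_id s).sub_const s
    have h := (h0.cosh.mul_const c).add (h0.sinh.mul_const b)
    simp only [id_eq, sub_self, Real.sinh_zero, Real.cosh_zero, zero_mul, zero_add, one_mul] at h
    exact h
  refine IsLocalMin.hasDerivAt_eq_zero (Eventually.of_forall fun t => ?_) hd
  simp only [← hg]
  exact Real.cosh_le_cosh.2 (by simpa [abs_of_nonneg dist_nonneg] using hmin t)

/-- The Gram determinant of three coplanar vectors vanishes. -/
theorem lorentzForm_sq_eq_of_orthogonal {y T w n u : ℝ × ℝ × ℝ} (hyy : lorentzForm y y = 1)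
    (hww : lorentzForm w w = 1) (hyT : lorentzForm y T = 0) (hTT : lorentzForm T T = -1)
    (hny : lorentzForm n y = 0) (hnT : lorentzForm n T = 0) (hnw : lorentzForm n w = 0)
    (hnu : lorentzForm n u ≠ 0) : lorentzForm w y ^ 2 = 1 + (-lorentzForm w T) ^ 2 := by
  let det (a b c : ℝ × ℝ × ℝ) : ℝ :=
    a.1 * (b.2.1 * c.2.2 - b.2.2 * c.2.1) - a.2.1 * (b.1 * c.2.2 - b.2.2 * c.1) +
      a.2.2 * (b.1 * c.2.1 - b.2.1 * c.1)
  have hcramer : det y T w * lorentzForm n u = det u T w * lorentzForm n y +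
      det y u w * lorentzForm n T + det y T u * lorentzForm n w := by
    simp only [det, lorentzForm]; ring
  have hdet : det y T w = 0 := by
    rw [hny, hnT, hnw] at hcramer
    simpa [hnu] using hcramer
  have hgram : lorentzForm y y * (lorentzForm T T * lorentzForm w w - lorentzForm w T ^ 2) -
      lorentzForm y T * (lorentzForm y T * lorentzForm w w - lorentzForm w T * lorentzForm w y) +
      lorentzForm w y * (lorentzForm y T * lorentzForm w T - lorentzForm T T * lorentzForm w y) =
      det y T w ^ 2 / 4 := by
    simp only [det, lorentzForm]; ring
  rw [hdet, hyy, hww, hyT, hTT] at hgram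
  linear_combination hgram

/-- A point of the plane orthogonal to a vector `n` lies on the geodesic orthogonal to `n`. -/
theorem mem_range_of_lorentzForm_eq_zero {γ : ℝ → ℍ} {s : ℝ} {T n u : ℝ × ℝ × ℝ} {z : ℍ}
    (hYT : lorentzForm (hyperboloidEmbed (γ s)) T = 0) (hTT : lorentzForm T T = -1)
    (hT : ∀ t, hyperboloidEmbed (γ t) =
      Real.cosh (t - s) • hyperboloidEmbed (γ s) + Real.sinh (t - s) • T)
    (hnY : lorentzForm n (hyperboloidEmbed (γ s)) = 0) (hnT : lorentzForm n T = 0)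
    (hnu : lorentzForm n u ≠ 0) (hnz : lorentzForm n (hyperboloidEmbed z) = 0) :
    z ∈ Set.range γ := by
  have hYY := lorentzForm_hyperboloidEmbed_self (γ s)
  have hzz := lorentzForm_hyperboloidEmbed_self z
  have hα := lorentzForm_hyperboloidEmbed z (γ s)
  obtain ⟨α, hαd⟩ : ∃ α, α = lorentzForm (hyperboloidEmbed z) (hyperboloidEmbed (γ s)) := ⟨_, rfl⟩
  obtain ⟨β, hβd⟩ : ∃ β, β = -lorentzForm (hyperboloidEmbed z) T := ⟨_, rfl⟩
  have hα0 : 0 < α := by rw [hαd, hα]; exact Real.cosh_pos _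
  have hgram : α ^ 2 = 1 + β ^ 2 := by
    rw [hαd, hβd]
    exact lorentzForm_sq_eq_of_orthogonal hYY hzz hYT hTT hnY hnT hnz hnu
  have hcosh : Real.cosh (Real.arsinh β) = α := by
    rw [Real.cosh_arsinh, ← hgram, Real.sqrt_sq hα0.le]
  refine ⟨s + Real.arsinh β, ?_⟩
  have h := lorentzForm_hyperboloidEmbed z (γ (s + Real.arsinh β))
  rw [hT, add_sub_cancel_left, hcosh, Real.sinh_arsinh, lorentzForm_add_right,
    lorentzForm_smul_right, lorentzForm_smul_right, ← hαd, ← neg_eq_iff_eq_neg.2 hβd] at h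
  have h1 : Real.cosh (dist z (γ (s + Real.arsinh β))) = 1 := by
    rw [← h]; linear_combination hgram
  by_contra hne
  exact (Real.one_lt_cosh.2 (dist_ne_zero.2 (Ne.symm hne))).ne' h1

/-- let `X` be a point at distance `< ε` from a geodesic `γ`, and
let `s` be a geodesic segment of length `L ≥ a` starting at `X` making an angle
`≤ φ/2` with the perpendicular from `X` to `γ`, where `ε` is the leg adjacent to
the acute angle `φ/2` in a hyperbolic right triangle with hypotenuse `a`
(hyperbolic trigonometry: `tanh ε = tanh a * cos (φ/2)`).  Then the segment
meets `γ`. -/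
theorem stmt4 (ε a φ : ℝ) (hε : 0 < ε) (ha : 0 < a) (hφ : 0 < φ) (hφπ : φ < Real.pi)
    (htrig : Real.tanh ε = Real.tanh a * Real.cos (φ / 2))
    (γ : ℝ → ℍ) (hγ : IsGeodesicLine γ)
    (X : ℍ) (hXγ : Metric.infDist X (Set.range γ) < ε)
    -- `y` is the foot of the perpendicular from `X` to `γ`
    (y : ℍ) (hy : y ∈ Set.range γ) (hyd : dist X y = Metric.infDist X (Set.range γ))
    -- `p` is the perpendicular geodesic segment from `X` to `y`
    (p : ℝ → ℍ) (hp : IsGeodesicSegmentOn p (dist X y)) (hp0 : p 0 = X)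
    (hp1 : p (dist X y) = y)
    -- `σ` is the geodesic segment of length `L ≥ a` starting at `X`
    (L : ℝ) (hL : a ≤ L)
    (σ : ℝ → ℍ) (hσ : IsGeodesicSegmentOn σ L) (hσ0 : σ 0 = X)
    -- the angle between `σ` and the perpendicular is at most `φ/2`
    (θ : ℝ) (hθ : AngleBetween σ p θ) (hθφ : θ ≤ φ / 2) :
    ∃ t ∈ Set.Icc (0 : ℝ) L, σ t ∈ Set.range γ := by
  obtain ⟨s, rfl⟩ := hy
  rcases (dist_nonneg (x := X) (y := γ s)).eq_or_lt with hd0 | hd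
  · exact ⟨0, ⟨le_rfl, (ha.trans_le hL).le⟩, s, by rw [hσ0]; exact (dist_eq_zero.1 hd0.symm).symm⟩
  have hL0 : 0 < L := ha.trans_le hL
  rw [← hyd] at hXγ
  obtain ⟨T, hYT, hTT, hT⟩ := exists_tangent_of_dist_eq (S := Set.univ)
    (fun s _ t _ => hγ s t) (Set.mem_univ s) (Set.mem_univ (s + 1)) (by simp)
  obtain ⟨V, hUV, -, hV⟩ := exists_tangent_of_dist_eq hσ ⟨le_rfl, hL0.le⟩ ⟨hL0.le, le_rfl⟩ hL0.ne
  obtain ⟨W, hUW, -, hW⟩ := exists_tangent_of_dist_eq hp ⟨le_rfl, hd.le⟩ ⟨hd.le, le_rfl⟩ hd.ne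
  simp only [sub_zero, hσ0, hp0] at hUV hV hUW hW
  have hUT : lorentzForm (hyperboloidEmbed X) T = 0 := by
    refine lorentzForm_tangent_eq_zero_of_isMin (fun t => hT t (Set.mem_univ t)) fun t => ?_
    rw [hyd]
    exact Metric.infDist_le_dist_of_mem (Set.mem_range_self t)
  have hUU := lorentzForm_hyperboloidEmbed_self X
  have hq : lorentzForm V W ≤ -Real.cos (φ / 2) :=
    lorentzForm_le_neg_cos_of_angleBetween (lt_min hL0 hd) hUU hUV hUW
      (fun t ht => hV t ⟨ht.1, ht.2.trans (min_le_left _ _)⟩)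
      (fun t ht => hW t ⟨ht.1, ht.2.trans (min_le_right _ _)⟩) hθ hθφ (by linarith) (by linarith)
  have hY := hW _ ⟨hd.le, le_rfl⟩
  rw [hp1] at hY
  have hYY := lorentzForm_hyperboloidEmbed_self (γ s)
  have hUY := lorentzForm_hyperboloidEmbed X (γ s)
  have hYV : lorentzForm (hyperboloidEmbed (γ s)) V =
      Real.sinh (dist X (γ s)) * lorentzForm V W := by
    rw [hY, lorentzForm_add_left, lorentzForm_smul_left, lorentzForm_smul_left, hUV,
      lorentzForm_comm W]
    ring
  set d := dist X (γ s)
  have hsd : 0 < Real.sinh d := Real.sinh_pos_iff.2 hd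
  have hcd := Real.cosh_pos d
  obtain ⟨n, hn⟩ : ∃ n, n = Real.cosh d • hyperboloidEmbed (γ s) - hyperboloidEmbed X := ⟨_, rfl⟩
  have hnv : ∀ v, lorentzForm n v = Real.cosh d * lorentzForm (hyperboloidEmbed (γ s)) v -
      lorentzForm (hyperboloidEmbed X) v := fun v => by
    rw [hn, lorentzForm_sub_left, lorentzForm_smul_left]
  have hnU : lorentzForm n (hyperboloidEmbed X) = Real.sinh d ^ 2 := by
    rw [hnv, lorentzForm_comm (hyperboloidEmbed (γ s)), hUY, hUU]
    linear_combination Real.cosh_sq d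
  have hside : ∀ t ∈ Set.Icc 0 L, lorentzForm n (hyperboloidEmbed (σ t)) =
      Real.sinh d * (Real.cosh t * Real.sinh d + Real.sinh t * Real.cosh d * lorentzForm V W) := by
    intro t ht
    rw [hV t ht, lorentzForm_add_right, lorentzForm_smul_right, lorentzForm_smul_right, hnU,
      hnv V, hYV, hUV]
    ring
  have hend : Real.cosh a * Real.sinh d + Real.sinh a * Real.cosh d * lorentzForm V W ≤ 0 := by
    have hsa : 0 < Real.sinh a := Real.sinh_pos_iff.2 ha
    have hcε := Real.cosh_pos ε
    have hca := Real.cosh_pos a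
    have h1 : Real.sinh ε * Real.cosh a = Real.sinh a * Real.cos (φ / 2) * Real.cosh ε := by
      rw [Real.tanh_eq_sinh_div_cosh, Real.tanh_eq_sinh_div_cosh] at htrig
      field_simp at htrig
      linarith
    have h2 : Real.sinh d * Real.cosh ε ≤ Real.cosh d * Real.sinh ε := by
      have h := Real.sinh_pos_iff.2 (sub_pos.2 hXγ)
      rw [Real.sinh_sub] at h
      linarith
    have h3 : Real.cosh a * Real.sinh d ≤ Real.sinh a * Real.cosh d * Real.cos (φ / 2) := by
      refine le_of_mul_le_mul_right ?_ hcε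
      calc Real.cosh a * Real.sinh d * Real.cosh ε
          = Real.cosh a * (Real.sinh d * Real.cosh ε) := by ring
        _ ≤ Real.cosh a * (Real.cosh d * Real.sinh ε) := by gcongr
        _ = _ := by linear_combination Real.cosh d * h1
    have h4 := mul_le_mul_of_nonneg_left hq (mul_pos hsa hcd).le
    linarith
  obtain ⟨t, ht, ht0⟩ : ∃ t ∈ Set.Icc 0 a,
      Real.cosh t * Real.sinh d + Real.sinh t * Real.cosh d * lorentzForm V W = 0 := by
    have hcont : ContinuousOn (fun t => Real.cosh t * Real.sinh d +
        Real.sinh t * Real.cosh d * lorentzForm V W) (Set.Icc 0 a) := by fun_prop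
    exact intermediate_value_Icc' ha.le hcont ⟨hend, by simpa using hsd.le⟩
  have htL : t ∈ Set.Icc 0 L := ⟨ht.1, ht.2.trans hL⟩
  refine ⟨t, htL, mem_range_of_lorentzForm_eq_zero (n := n) (u := hyperboloidEmbed X) hYT hTT
    (fun t => hT t (Set.mem_univ t)) ?_ ?_ ?_ ?_⟩
  · rw [hnv, hYY, hUY]; ring
  · rw [hnv, hYT, hUT]; ring
  · rw [hnU]; positivity
  · rw [hside t htL, ht0, mul_zero]
end

section
/- Let Γ be a Fuchsian group of finite covolume whose Dirichlet domain D has at least one finite vertex. For any point y ∈ ℍ and any two distinct directions η₁, η₂ at y, there is a direction strictly between η₁ and η₂ that points from y toward a vertex of the tessellation ΓD lying in ℍ (a finite vertex). Equivalently, the set of directions from y to finite vertices is dense in the circle of directions at y. -/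
open UpperHalfPlane Set Filter MeasureTheory Pointwise

local notation "SL2R" => Matrix.SpecialLinearGroup (Fin 2) ℝ

/-- A subgroup of `SL(2,ℝ)`, acting on `ℍ` by Möbius transformations, is
Fuchsian iff it acts properly discontinuously (equivalent to discreteness). -/
def IsFuchsian (Γ : Subgroup SL2R) : Prop :=
  ∀ z : ℍ, ∀ r : ℝ, {γ : Γ | dist (((γ : SL2R)) • z) z ≤ r}.Finite

/-- The Dirichlet domain of `Γ` centered at `x`. -/
def DirichletDomain (Γ : Subgroup SL2R) (x : ℍ) : Set ℍ :=
  {z : ℍ | ∀ γ : Γ, dist z x ≤ dist z (((γ : SL2R)) • x)}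

/-- `x` is fixed by no element of `Γ` other than `±1` (which act trivially). -/
def FreeCenter (Γ : Subgroup SL2R) (x : ℍ) : Prop :=
  ∀ γ : Γ, ((γ : SL2R)) • x = x → (γ : SL2R) = 1 ∨ (γ : SL2R) = -1

/-- The hyperbolic area of a subset of the upper half-plane. -/
noncomputable def hypArea (S : Set ℍ) : ENNReal :=
  ∫⁻ z in ((fun w : ℍ => (w : ℂ)) '' S), ENNReal.ofReal (1 / z.im ^ 2)

/-- A (finite) vertex of the tessellation of `ℍ` by the copies of `D`:
a point of `ℍ` lying in at least three distinct tiles. -/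
def IsTessVertex (Γ : Subgroup SL2R) (D : Set ℍ) (v : ℍ) : Prop :=
  ∃ a b c : Γ, (a : SL2R) • D ≠ (b : SL2R) • D ∧ (a : SL2R) • D ≠ (c : SL2R) • D ∧
    (b : SL2R) • D ≠ (c : SL2R) • D ∧
    v ∈ (a : SL2R) • D ∧ v ∈ (b : SL2R) • D ∧ v ∈ (c : SL2R) • D

/-- An edge of the tessellation: the (infinite) intersection of two distinct
tiles. -/
def IsTessEdge (Γ : Subgroup SL2R) (D : Set ℍ) (e : Set ℍ) : Prop :=
  ∃ a b : Γ, (a : SL2R) • D ≠ (b : SL2R) • D ∧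
    e = ((a : SL2R) • D) ∩ ((b : SL2R) • D) ∧ e.Infinite

/-- Hyperbolic convexity of a subset of `ℍ`. -/
def IsHConvex (S : Set ℍ) : Prop :=
  ∀ γ : ℝ → ℍ, IsGeodesicLine γ →
    ∀ a b : ℝ, γ a ∈ S → γ b ∈ S → ∀ c ∈ Set.uIcc a b, γ c ∈ S

theorem hypArea_eq_volume (S : Set ℍ) : hypArea S = volume S := by
  rw [volume_eq_lintegral, hypArea]
  congr 1
  ext z
  rw [← ENNReal.ofReal_coe_nnreal]
  congr 1
  simp

/-- A Fuchsian group is countable. -/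
theorem IsFuchsian.countable {Γ : Subgroup SL2R} (hΓ : IsFuchsian Γ) : Countable Γ := by
  rw [← Set.countable_univ_iff]
  have : (univ : Set Γ) = ⋃ n : ℕ, {γ : Γ | dist ((γ : SL2R) • I) I ≤ n} := by
    ext γ
    simpa using exists_nat_ge (dist ((γ : SL2R) • I) I)
  rw [this]
  exact Set.countable_iUnion fun n => (hΓ I n).countable

theorem dist_smul_smul (g : SL2R) (p q : ℍ) : dist (g • p) (g • q) = dist p q :=
  _root_.dist_smul g p q

/-- Moving the centre of the displacement condition in the definition of a Fuchsian group. -/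
theorem IsFuchsian.finite_dist_smul_le {Γ : Subgroup SL2R} (hΓ : IsFuchsian Γ) (z x : ℍ) (r : ℝ) :
    {γ : Γ | dist z ((γ : SL2R) • x) ≤ r}.Finite := by
  refine (hΓ x (r + dist z x)).subset fun γ hγ => ?_
  have h₁ := dist_triangle ((γ : SL2R) • x) z x
  rw [dist_comm ((γ : SL2R) • x) z] at h₁
  simp only [mem_ofPred_eq] at hγ ⊢
  linarith

/-- The translates of a Dirichlet domain cover the plane. -/
theorem IsFuchsian.exists_mem_smul_dirichletDomain {Γ : Subgroup SL2R} (hΓ : IsFuchsian Γ)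
    (x z : ℍ) : ∃ γ : Γ, z ∈ (γ : SL2R) • DirichletDomain Γ x := by
  obtain ⟨γ, hγ, hmin⟩ := (hΓ.finite_dist_smul_le z x (dist z x)).exists_minimalFor
    (fun γ : Γ => dist z ((γ : SL2R) • x)) _ ⟨1, by simp⟩
  refine ⟨γ, ?_⟩
  rw [Set.mem_smul_set_iff_inv_smul_mem]
  intro δ
  have e₁ : dist ((γ : SL2R)⁻¹ • z) x = dist z ((γ : SL2R) • x) := by
    rw [← dist_smul_smul (γ : SL2R), smul_inv_smul]
  have e₂ : dist ((γ : SL2R)⁻¹ • z) ((δ : SL2R) • x) = dist z (((γ * δ : Γ) : SL2R) • x) := by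
    rw [← dist_smul_smul (γ : SL2R), smul_inv_smul, smul_smul, Subgroup.coe_mul]
  rw [e₁, e₂]
  by_cases h : dist z (((γ * δ : Γ) : SL2R) • x) ≤ dist z x
  · by_contra! hlt
    exact absurd (hmin h hlt.le) (not_le.mpr hlt)
  · exact le_trans hγ (not_le.mp h).le

theorem volume_smul (g : SL2R) (S : Set ℍ) : volume (g • S) = volume S :=
  measure_smul volume (Matrix.SpecialLinearGroup.mapGL ℝ g : GL (Fin 2) ℝ) S

/-- In a group of finite covolume, an open set that meets only finitely many of its translates has
finite area. -/
theorem IsFuchsian.volume_lt_top_of_finite {Γ : Subgroup SL2R} (hΓ : IsFuchsian Γ) {x : ℍ}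
    (hvol : volume (DirichletDomain Γ x) < ⊤) {U : Set ℍ} (hU : IsOpen U)
    (hfin : {γ : Γ | ∃ p ∈ U, (γ : SL2R) • p ∈ U}.Finite) : volume U < ⊤ := by
  have := hΓ.countable
  set D := DirichletDomain Γ x
  set F := {γ : Γ | ∃ p ∈ U, (γ : SL2R) • p ∈ U}
  have hpre (γ : Γ) : MeasurableSet {p : ℍ | (γ : SL2R) • p ∈ U} :=
    (hU.preimage (isometry_smul ℍ (γ : SL2R)).continuous).measurableSet
  have hcover : U ⊆ ⋃ γ : Γ, (γ : SL2R) • ({p : ℍ | (γ : SL2R) • p ∈ U} ∩ D) := by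
    intro p hp
    obtain ⟨γ, q, hq, rfl⟩ := hΓ.exists_mem_smul_dirichletDomain x p
    exact mem_iUnion.mpr ⟨γ, q, ⟨hp, hq⟩, rfl⟩
  have hmult (p : ℍ) : ∑' γ : Γ, {p : ℍ | (γ : SL2R) • p ∈ U}.indicator 1 p
      ≤ (F.encard : ENNReal) := by
    have hind : (fun γ : Γ => {p : ℍ | (γ : SL2R) • p ∈ U}.indicator (1 : ℍ → ENNReal) p) =
        {γ : Γ | (γ : SL2R) • p ∈ U}.indicator 1 := by
      ext γ
      simp [Set.indicator]
    rw [hind, ← tsum_subtype {γ : Γ | (γ : SL2R) • p ∈ U} (1 : Γ → ENNReal)]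
    simp only [Pi.one_apply, ENNReal.tsum_set_one]
    norm_cast
    rcases {γ : Γ | (γ : SL2R) • p ∈ U}.eq_empty_or_nonempty with h | ⟨γ₀, h₀⟩
    · simp [h]
    · refine Set.encard_le_encard_of_injOn (f := fun γ => γ * γ₀⁻¹) (fun γ hγ => ?_)
        (fun a _ b _ hab => mul_right_cancel hab)
      refine ⟨(γ₀ : SL2R) • p, h₀, ?_⟩
      simpa [mul_smul] using hγ
  calc volume U ≤ ∑' γ : Γ, volume ((γ : SL2R) • ({p : ℍ | (γ : SL2R) • p ∈ U} ∩ D)) :=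
        (measure_mono hcover).trans (measure_iUnion_le _)
    _ = ∑' γ : Γ, ∫⁻ p in D, {p : ℍ | (γ : SL2R) • p ∈ U}.indicator 1 p := by
        congr 1
        ext γ
        rw [volume_smul, lintegral_indicator_one (hpre γ), Measure.restrict_apply (hpre γ)]
    _ = ∫⁻ p in D, ∑' γ : Γ, {p : ℍ | (γ : SL2R) • p ∈ U}.indicator 1 p :=
        (lintegral_tsum fun γ => (measurable_one.indicator (hpre γ)).aemeasurable).symm
    _ ≤ ∫⁻ _ in D, (F.encard : ENNReal) := lintegral_mono hmult
    _ = F.encard * volume D := by simp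
    _ < ⊤ := by
        refine ENNReal.mul_lt_top ?_ hvol
        rw [hfin.encard_eq_coe_toFinset_card]
        simp

/-- If the Gromov products based at `v` of points of `U` with points of the orbit of `v` are
bounded, then `U` meets only finitely many of its translates. -/
theorem IsFuchsian.finite_of_gromov {Γ : Subgroup SL2R} (hΓ : IsFuchsian Γ) {v : ℍ} {U : Set ℍ}
    {K : ℝ} (hK : ∀ p ∈ U, ∀ γ : Γ,
      dist p v + dist v ((γ : SL2R) • v) - K ≤ dist p ((γ : SL2R) • v)) :
    {γ : Γ | ∃ p ∈ U, (γ : SL2R) • p ∈ U}.Finite := by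
  refine (hΓ v K).subset ?_
  rintro γ ⟨p, hp, hq⟩
  have h₁ := hK p hp γ⁻¹
  have h₂ := hK _ hq γ
  rw [Subgroup.coe_inv, ← dist_smul_smul (γ : SL2R) p v,
    ← dist_smul_smul (γ : SL2R) p ((γ : SL2R)⁻¹ • v),
    ← dist_smul_smul (γ : SL2R) v ((γ : SL2R)⁻¹ • v), smul_inv_smul] at h₁
  rw [dist_comm v] at h₂
  simp only [mem_ofPred_eq]
  linarith

/-- A set containing a one-sided neighbourhood of a real boundary point has infinite area. -/
theorem volume_eq_top_of_box {U : Set ℍ} {x₀ r : ℝ} (hr : 0 < r)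
    (hU : ∀ p : ℍ, |p.re - x₀| < r → p.im < r → p ∈ U) : volume U = ⊤ := by
  refine ENNReal.eq_top_of_forall_nnreal_le fun M => ?_
  obtain ⟨s, hs, hsr, hsM⟩ : ∃ s : ℝ, 0 < s ∧ s < r ∧ M * s ≤ r := by
    refine ⟨min (r / 2) (r / (M + 1)), by positivity, by
      linarith [min_le_left (r / 2) (r / (M + 1))], ?_⟩
    calc (M : ℝ) * min (r / 2) (r / (M + 1)) ≤ (M + 1) * (r / (M + 1)) := by
          gcongr
          · linarith
          · exact min_le_right _ _
      _ = r := by field_simp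
  set B : Set ℂ := Ioo (x₀ - r) (x₀ + r) ×ℂ Ioo (s / 2) s
  have hB : MeasurableSet B := (isOpen_Ioo.reProdIm isOpen_Ioo).measurableSet
  have hvB : volume B = ENNReal.ofReal (r * s) := by
    have : B = Complex.measurableEquivRealProd ⁻¹' (Ioo (x₀ - r) (x₀ + r) ×ˢ Ioo (s / 2) s) := rfl
    rw [this, Complex.volume_preserving_equiv_real_prod.measure_preimage_equiv,
      Measure.volume_eq_prod, Measure.prod_prod, Real.volume_Ioo, Real.volume_Ioo,
      ← ENNReal.ofReal_mul (by linarith)]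
    congr 1
    ring
  have hBU : B ⊆ (fun w : ℍ => (w : ℂ)) '' U := by
    rintro w ⟨hre, him⟩
    have hpos : 0 < w.im := by have := him.1; linarith
    refine ⟨⟨w, hpos⟩, hU _ ?_ ?_, rfl⟩
    · change |w.re - x₀| < r
      rw [abs_lt]
      exact ⟨by linarith [hre.1], by linarith [hre.2]⟩
    · exact lt_trans him.2 hsr
  rw [← hypArea_eq_volume]
  calc (M : ENNReal) = ENNReal.ofReal M := by simp
    _ ≤ ENNReal.ofReal (1 / s ^ 2) * volume B := by
        rw [hvB, ← ENNReal.ofReal_mul (by positivity)]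
        apply ENNReal.ofReal_le_ofReal
        rw [one_div_mul_eq_div, le_div_iff₀ (by positivity)]
        nlinarith
    _ = ∫⁻ _ in B, ENNReal.ofReal (1 / s ^ 2) := by simp
    _ ≤ ∫⁻ z in B, ENNReal.ofReal (1 / z.im ^ 2) := by
        refine setLIntegral_mono' hB fun z hz => ENNReal.ofReal_le_ofReal ?_
        have h₁ := hz.2.1
        have h₂ := hz.2.2
        have : 0 < z.im := by linarith
        gcongr
    _ ≤ hypArea U := lintegral_mono_set hBU

/-- First spatial coordinate of `p` in the hyperboloid model centred at `y`. -/
noncomputable def hypX (y p : ℍ) : ℝ :=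
  ((p.re - y.re) ^ 2 + p.im ^ 2 - y.im ^ 2) / (2 * y.im * p.im)

/-- Second spatial coordinate of `p` in the hyperboloid model centred at `y`. -/
noncomputable def hypY (y p : ℍ) : ℝ := (p.re - y.re) / p.im

theorem cosh_dist_eq_div (y p : ℍ) : Real.cosh (dist y p) =
    ((p.re - y.re) ^ 2 + p.im ^ 2 + y.im ^ 2) / (2 * y.im * p.im) := by
  rw [cosh_dist']
  ring

theorem cosh_dist_eq_hyp (y p q : ℍ) : Real.cosh (dist p q) =
    Real.cosh (dist y p) * Real.cosh (dist y q) - hypX y p * hypX y q - hypY y p * hypY y q := by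
  have hy := y.im_ne_zero
  have hp := p.im_ne_zero
  have hq := q.im_ne_zero
  rw [cosh_dist_eq_div, cosh_dist_eq_div, cosh_dist_eq_div, hypX, hypX, hypY, hypY]
  field_simp
  ring

theorem cosh_dist_sq (y p : ℍ) :
    Real.cosh (dist y p) ^ 2 = 1 + hypX y p ^ 2 + hypY y p ^ 2 := by
  have h := cosh_dist_eq_hyp y p p
  rw [dist_self, Real.cosh_zero] at h
  linarith

theorem eq_of_hyp_eq {y p q : ℍ} (hX : hypX y p = hypX y q) (hY : hypY y p = hypY y q) :
    p = q := by
  have hp := cosh_dist_sq y p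
  have hq := cosh_dist_sq y q
  have hpq : Real.cosh (dist y p) = Real.cosh (dist y q) := by
    rw [hX, hY, ← hq] at hp
    exact (pow_left_inj₀ (Real.cosh_pos _).le (Real.cosh_pos _).le two_ne_zero).mp hp
  have h := cosh_dist_eq_hyp y p q
  rw [hX, hY, hpq] at h
  have h1 : Real.cosh (dist p q) = 1 := by linarith
  by_contra hne
  exact absurd h1 (Real.one_lt_cosh.mpr (dist_ne_zero.mpr hne)).ne'

@[fun_prop]
theorem continuous_hypX (y : ℍ) : Continuous (hypX y) := by
  unfold hypX
  have h : ∀ p : ℍ, 2 * y.im * p.im ≠ 0 := fun p =>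
    mul_ne_zero (mul_ne_zero two_ne_zero y.im_ne_zero) p.im_ne_zero
  exact Continuous.div (by fun_prop) (by fun_prop) h

@[fun_prop]
theorem continuous_hypY (y : ℍ) : Continuous (hypY y) := by
  unfold hypY
  exact Continuous.div (by fun_prop) (by fun_prop) fun p => p.im_ne_zero

theorem sub_pos_hyperboloid (w : ℝ × ℝ) : 0 < √(1 + w.1 ^ 2 + w.2 ^ 2) - w.1 := by
  rw [sub_pos]
  apply Real.lt_sqrt_of_sq_lt
  nlinarith [sq_nonneg w.2]

/-- The point with prescribed spatial coordinates in the hyperboloid model centred at `y`. -/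
noncomputable def ofHyp (y : ℍ) (w : ℝ × ℝ) : ℍ :=
  ⟨⟨y.re + w.2 * (y.im / (√(1 + w.1 ^ 2 + w.2 ^ 2) - w.1)),
    y.im / (√(1 + w.1 ^ 2 + w.2 ^ 2) - w.1)⟩, div_pos y.im_pos (sub_pos_hyperboloid w)⟩

theorem ofHyp_im (y : ℍ) (w : ℝ × ℝ) :
    (ofHyp y w).im = y.im / (√(1 + w.1 ^ 2 + w.2 ^ 2) - w.1) := rfl

theorem ofHyp_re (y : ℍ) (w : ℝ × ℝ) :
    (ofHyp y w).re = y.re + w.2 * (y.im / (√(1 + w.1 ^ 2 + w.2 ^ 2) - w.1)) := rfl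

theorem hypY_ofHyp (y : ℍ) (w : ℝ × ℝ) : hypY y (ofHyp y w) = w.2 := by
  have h := (sub_pos_hyperboloid w).ne'
  have hy := y.im_ne_zero
  rw [hypY, ofHyp_re, ofHyp_im]
  field_simp
  ring

theorem hypX_ofHyp (y : ℍ) (w : ℝ × ℝ) : hypX y (ofHyp y w) = w.1 := by
  have h := (sub_pos_hyperboloid w).ne'
  have hy := y.im_ne_zero
  have hsq : √(1 + w.1 ^ 2 + w.2 ^ 2) ^ 2 = 1 + w.1 ^ 2 + w.2 ^ 2 := Real.sq_sqrt (by positivity)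
  rw [hypX, ofHyp_re, ofHyp_im]
  field_simp
  linear_combination (-y.im ^ 2) * hsq

theorem continuous_ofHyp (y : ℍ) : Continuous (ofHyp y) := by
  rw [isOpenEmbedding_coe.isInducing.continuous_iff,
    Complex.equivRealProdCLM.toHomeomorph.isInducing.continuous_iff]
  have h : ∀ w : ℝ × ℝ, √(1 + w.1 ^ 2 + w.2 ^ 2) - w.1 ≠ 0 := fun w => (sub_pos_hyperboloid w).ne'
  have hd : Continuous fun w : ℝ × ℝ => y.im / (√(1 + w.1 ^ 2 + w.2 ^ 2) - w.1) :=
    Continuous.div (by fun_prop) (by fun_prop) h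
  exact (continuous_const.add (continuous_snd.mul hd)).prodMk hd

theorem ofHyp_hyp (y p : ℍ) : ofHyp y (hypX y p, hypY y p) = p :=
  eq_of_hyp_eq (hypX_ofHyp y _) (hypY_ofHyp y _)

/-- A geodesic line through `y` is a line through the origin in the hyperboloid coordinates. -/
theorem IsGeodesicLine.exists_linear {y : ℍ} {γ : ℝ → ℍ} (hγ : IsGeodesicLine γ)
    (hy : y ∈ range γ) :
    ∃ α β : ℝ, ∀ p : ℍ, p ∈ range γ ↔ α * hypX y p + β * hypY y p = 0 := by
  obtain ⟨t₀, rfl⟩ := hy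
  set y := γ t₀
  have hcosh (s : ℝ) : Real.cosh (dist y (γ (t₀ + s))) = Real.cosh s := by
    rw [hγ, Real.cosh_abs, show t₀ - (t₀ + s) = -s by ring, Real.cosh_neg]
  have hsq (s : ℝ) :
      hypX y (γ (t₀ + s)) ^ 2 + hypY y (γ (t₀ + s)) ^ 2 = Real.sinh s ^ 2 := by
    have h := cosh_dist_sq y (γ (t₀ + s))
    rw [hcosh, Real.cosh_sq] at h
    linarith
  set a := hypX y (γ (t₀ + 1)) with ha
  set b := hypY y (γ (t₀ + 1)) with hb
  have hab : a ^ 2 + b ^ 2 = Real.sinh 1 ^ 2 := hsq 1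
  have hs : 0 < Real.sinh 1 := Real.sinh_pos_iff.mpr one_pos
  have hinner (s : ℝ) :
      hypX y (γ (t₀ + s)) * a + hypY y (γ (t₀ + s)) * b = Real.sinh s * Real.sinh 1 := by
    have h := cosh_dist_eq_hyp y (γ (t₀ + s)) (γ (t₀ + 1))
    rw [hcosh, hcosh, hγ, Real.cosh_abs, show t₀ + s - (t₀ + 1) = s - 1 by ring,
      Real.cosh_sub] at h
    linarith
  have hline (s : ℝ) : hypX y (γ (t₀ + s)) * Real.sinh 1 = Real.sinh s * a ∧
      hypY y (γ (t₀ + s)) * Real.sinh 1 = Real.sinh s * b := by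
    have h0 : (hypX y (γ (t₀ + s)) * Real.sinh 1 - Real.sinh s * a) ^ 2 +
        (hypY y (γ (t₀ + s)) * Real.sinh 1 - Real.sinh s * b) ^ 2 = 0 := by
      linear_combination Real.sinh 1 ^ 2 * hsq s + Real.sinh s ^ 2 * hab -
        2 * Real.sinh s * Real.sinh 1 * hinner s
    constructor <;> nlinarith [sq_nonneg (hypX y (γ (t₀ + s)) * Real.sinh 1 - Real.sinh s * a),
      sq_nonneg (hypY y (γ (t₀ + s)) * Real.sinh 1 - Real.sinh s * b)]
  refine ⟨b, -a, fun p => ⟨?_, fun hp => ?_⟩⟩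
  · rintro ⟨t, rfl⟩
    obtain ⟨h₁, h₂⟩ := hline (t - t₀)
    rw [add_sub_cancel] at h₁ h₂
    apply mul_right_cancel₀ hs.ne'
    linear_combination b * h₁ - a * h₂
  · set l := (hypX y p * a + hypY y p * b) / Real.sinh 1 with hl
    have hl' : l * Real.sinh 1 = hypX y p * a + hypY y p * b := by rw [hl]; field_simp
    refine ⟨t₀ + Real.arsinh l, ?_⟩
    obtain ⟨h₁, h₂⟩ := hline (Real.arsinh l)
    rw [Real.sinh_arsinh] at h₁ h₂
    have hs2 : Real.sinh 1 ^ 2 ≠ 0 := pow_ne_zero 2 hs.ne'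
    apply eq_of_hyp_eq (y := y)
    · apply mul_right_cancel₀ hs2
      linear_combination Real.sinh 1 * h₁ + a * hl' + hypX y p * hab - b * hp
    · apply mul_right_cancel₀ hs2
      linear_combination Real.sinh 1 * h₂ + b * hl' + hypY y p * hab + a * hp

theorem IsGeodesicLine.exists_linear_pos {y z : ℍ} {γ : ℝ → ℍ} (hγ : IsGeodesicLine γ)
    (hy : y ∈ range γ) (hz : z ∉ range γ) :
    ∃ α β : ℝ, (∀ p ∈ range γ, α * hypX y p + β * hypY y p = 0) ∧
      0 < α * hypX y z + β * hypY y z := by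
  obtain ⟨α, β, h⟩ := hγ.exists_linear hy
  rw [h] at hz
  rcases lt_or_gt_of_ne hz with hneg | hpos
  · refine ⟨-α, -β, fun p hp => ?_, by linarith⟩
    linarith [(h p).mp hp]
  · exact ⟨α, β, fun p hp => (h p).mp hp, hpos⟩

/-- An open sector in the hyperboloid coordinates is connected. -/
theorem isPreconnected_sector (y : ℍ) (α₁ β₁ α₂ β₂ : ℝ) :
    IsPreconnected {p : ℍ | 0 < α₁ * hypX y p + β₁ * hypY y p ∧
      0 < α₂ * hypX y p + β₂ * hypY y p} := by
  set C : Set (ℝ × ℝ) := {w | 0 < α₁ * w.1 + β₁ * w.2 ∧ 0 < α₂ * w.1 + β₂ * w.2}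
  have hC : Convex ℝ C := by
    have h (α β : ℝ) : Convex ℝ {w : ℝ × ℝ | 0 < α * w.1 + β * w.2} :=
      convex_halfSpace_gt (f := fun w : ℝ × ℝ => α * w.1 + β * w.2)
        ⟨fun u v => by simp; ring, fun c u => by simp; ring⟩ 0
    exact (h α₁ β₁).inter (h α₂ β₂)
  convert hC.isPreconnected.image (ofHyp y) (continuous_ofHyp y).continuousOn using 1
  ext p
  constructor
  · intro hp
    exact ⟨(hypX y p, hypY y p), hp, ofHyp_hyp y p⟩
  · rintro ⟨w, hw, rfl⟩
    simpa only [C, mem_ofPred_eq, hypX_ofHyp, hypY_ofHyp] using hw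

/-- A point well inside a half-plane bounded by a geodesic through `y` and a point outside that
half-plane are seen from `y` under an angle bounded below. -/
theorem le_cosh_dist_of_separated {y p c : ℍ} {α β ε : ℝ} (hε : 0 < ε)
    (hp : ε * Real.cosh (dist y p) < α * hypX y p + β * hypY y p)
    (hc : α * hypX y c + β * hypY y c ≤ 0) :
    0 < α ^ 2 + β ^ 2 ∧ ε ^ 2 / (2 * (α ^ 2 + β ^ 2)) *
      (Real.cosh (dist y p) * Real.cosh (dist y c)) ≤ Real.cosh (dist p c) := by
  have hP := Real.cosh_pos (dist y p)
  have hQ := Real.cosh_pos (dist y c)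
  have hPs := cosh_dist_sq y p
  have hQs := cosh_dist_sq y c
  rw [cosh_dist_eq_hyp y p c]
  set P := Real.cosh (dist y p)
  set Q := Real.cosh (dist y c)
  set X := hypX y p
  set Y := hypY y p
  set X' := hypX y c
  set Y' := hypY y c
  have hA : 0 < α ^ 2 + β ^ 2 := by
    rcases eq_or_ne α 0 with rfl | hα
    · rcases eq_or_ne β 0 with rfl | hβ
      · nlinarith [mul_pos hε hP]
      · positivity
    · positivity
  refine ⟨hA, ?_⟩
  have h₁ : ε * (P * Q) ≤ α * (X * Q - X' * P) + β * (Y * Q - Y' * P) := by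
    nlinarith [mul_le_mul_of_nonneg_right hp.le hQ.le, mul_nonneg hP.le (neg_nonneg.mpr hc)]
  have h₂ : (ε * (P * Q)) ^ 2 ≤ (α * (X * Q - X' * P) + β * (Y * Q - Y' * P)) ^ 2 :=
    pow_le_pow_left₀ (by positivity) h₁ 2
  have h₃ : (α * (X * Q - X' * P) + β * (Y * Q - Y' * P)) ^ 2 ≤
      (α ^ 2 + β ^ 2) * ((X * Q - X' * P) ^ 2 + (Y * Q - Y' * P) ^ 2) := by
    nlinarith [sq_nonneg (α * (Y * Q - Y' * P) - β * (X * Q - X' * P))]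
  have h₄ : (X * Q - X' * P) ^ 2 + (Y * Q - Y' * P) ^ 2 ≤
      2 * (P * Q) * (P * Q - X * X' - Y * Y') := by
    have e : 2 * (P * Q) * (P * Q - X * X' - Y * Y') -
        ((X * Q - X' * P) ^ 2 + (Y * Q - Y' * P) ^ 2) = P ^ 2 + Q ^ 2 := by
      linear_combination Q ^ 2 * hPs + P ^ 2 * hQs
    nlinarith [sq_nonneg P, sq_nonneg Q]
  have h₅ : (ε * (P * Q)) ^ 2 ≤
      (α ^ 2 + β ^ 2) * (2 * (P * Q) * (P * Q - X * X' - Y * Y')) :=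
    h₂.trans (h₃.trans (by gcongr))
  rw [div_mul_eq_mul_div, div_le_iff₀ (by positivity)]
  have hPQ : 0 < P * Q := mul_pos hP hQ
  refine le_of_mul_le_mul_right ?_ hPQ
  linarith

/-- A lower bound for `cosh` of a distance is an upper bound for a Gromov product. -/
theorem gromov_of_le_cosh {y p c : ℍ} {δ : ℝ} (hδ : 0 < δ)
    (h : δ * (Real.cosh (dist y p) * Real.cosh (dist y c)) ≤ Real.cosh (dist p c)) :
    dist y p + dist y c + Real.log (δ / 4) ≤ dist p c := by
  have hlow (t : ℝ) : Real.exp t / 2 ≤ Real.cosh t := by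
    rw [Real.cosh_eq]
    linarith [Real.exp_pos (-t)]
  have hup : Real.cosh (dist p c) ≤ Real.exp (dist p c) := by
    rw [Real.cosh_eq]
    have h₀ : -dist p c ≤ dist p c := by linarith [dist_nonneg (x := p) (y := c)]
    linarith [Real.exp_le_exp.mpr h₀]
  rw [← Real.exp_le_exp, Real.exp_add, Real.exp_add, Real.exp_log (by positivity)]
  calc Real.exp (dist y p) * Real.exp (dist y c) * (δ / 4)
      = δ * (Real.exp (dist y p) / 2 * (Real.exp (dist y c) / 2)) := by ring
    _ ≤ δ * (Real.cosh (dist y p) * Real.cosh (dist y c)) := by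
        gcongr
        · exact hlow _
        · exact hlow _
    _ ≤ _ := h.trans hup

/-- An open sector at `y` accumulates at some real boundary point in its interior. -/
theorem exists_boundary_point {a b α₁ β₁ α₂ β₂ X Y : ℝ} (hb : 0 < b)
    (h₁ : 0 < α₁ * X + β₁ * Y) (h₂ : 0 < α₂ * X + β₂ * Y) :
    ∃ x₀ : ℝ, 0 < α₁ * ((x₀ - a) ^ 2 - b ^ 2) + β₁ * (2 * b * (x₀ - a)) ∧
      0 < α₂ * ((x₀ - a) ^ 2 - b ^ 2) + β₂ * (2 * b * (x₀ - a)) := by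
  obtain ⟨y, ⟨hy₁, hy₂⟩, hy⟩ : ({t : ℝ | 0 < α₁ * X + β₁ * t ∧ 0 < α₂ * X + β₂ * t} ∩
      {0}ᶜ).Nonempty := by
    apply (dense_compl_singleton (0 : ℝ)).inter_open_nonempty
    · rw [Set.ofPred_and]
      exact (isOpen_lt (by fun_prop) (by fun_prop)).inter (isOpen_lt (by fun_prop) (by fun_prop))
    · exact ⟨Y, h₁, h₂⟩
  replace hy : y ≠ 0 := hy
  have hR : √(X ^ 2 + y ^ 2) ^ 2 = X ^ 2 + y ^ 2 := Real.sq_sqrt (by positivity)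
  have hpos : 0 < X + √(X ^ 2 + y ^ 2) := by
    have : -X < √(X ^ 2 + y ^ 2) := by
      apply Real.lt_sqrt_of_sq_lt
      have := sq_pos_of_ne_zero hy
      nlinarith
    linarith
  set R := √(X ^ 2 + y ^ 2)
  have key (α β : ℝ) : α * ((a + b * ((X + R) / y) - a) ^ 2 - b ^ 2) +
      β * (2 * b * (a + b * ((X + R) / y) - a)) =
      2 * b ^ 2 * (X + R) / y ^ 2 * (α * X + β * y) := by
    field_simp
    linear_combination α * b ^ 2 * hR
  refine ⟨a + b * ((X + R) / y), ?_, ?_⟩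
  · rw [key]
    positivity
  · rw [key]
    positivity

/-- An open sector at `y` contains an open set of infinite area whose points have bounded Gromov
product, based at `y`, with the points outside the sector. -/
theorem exists_infinite_area_subset (y : ℍ) {z : ℍ} {α₁ β₁ α₂ β₂ : ℝ}
    (h₁ : 0 < α₁ * hypX y z + β₁ * hypY y z) (h₂ : 0 < α₂ * hypX y z + β₂ * hypY y z) :
    ∃ U : Set ℍ, IsOpen U ∧ volume U = ⊤ ∧ ∃ K : ℝ, ∀ p ∈ U, ∀ c : ℍ,
      ¬ (0 < α₁ * hypX y c + β₁ * hypY y c ∧ 0 < α₂ * hypX y c + β₂ * hypY y c) →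
        dist y p + dist y c - K ≤ dist p c := by
  obtain ⟨x₀, hx₁, hx₂⟩ := exists_boundary_point (a := y.re) y.im_pos h₁ h₂
  have hb := y.im_pos
  have hden : 0 < (x₀ - y.re) ^ 2 + y.im ^ 2 := by positivity
  obtain ⟨ε, hε, hε₁, hε₂⟩ : ∃ ε : ℝ, 0 < ε ∧
      ε * ((x₀ - y.re) ^ 2 + y.im ^ 2) <
        α₁ * ((x₀ - y.re) ^ 2 - y.im ^ 2) + β₁ * (2 * y.im * (x₀ - y.re)) ∧
      ε * ((x₀ - y.re) ^ 2 + y.im ^ 2) <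
        α₂ * ((x₀ - y.re) ^ 2 - y.im ^ 2) + β₂ * (2 * y.im * (x₀ - y.re)) := by
    obtain ⟨m, hm, hmlt⟩ := exists_between (lt_min hx₁ hx₂)
    refine ⟨m / ((x₀ - y.re) ^ 2 + y.im ^ 2), by positivity, ?_⟩
    rw [div_mul_cancel₀ _ hden.ne']
    exact lt_min_iff.mp hmlt
  have hbox (α β : ℝ) (h : ε * ((x₀ - y.re) ^ 2 + y.im ^ 2) <
      α * ((x₀ - y.re) ^ 2 - y.im ^ 2) + β * (2 * y.im * (x₀ - y.re))) :
      ∃ r > 0, ∀ p : ℍ, |p.re - x₀| < r → p.im < r →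
        ε * Real.cosh (dist y p) < α * hypX y p + β * hypY y p := by
    have ho : IsOpen {w : ℝ × ℝ | ε * ((w.1 - y.re) ^ 2 + w.2 ^ 2 + y.im ^ 2) <
        α * ((w.1 - y.re) ^ 2 + w.2 ^ 2 - y.im ^ 2) + β * (2 * y.im * (w.1 - y.re))} :=
      isOpen_lt (by fun_prop) (by fun_prop)
    obtain ⟨r, hr, hball⟩ := Metric.isOpen_iff.mp ho (x₀, 0) (by simpa using h)
    refine ⟨r, hr, fun p hre him => ?_⟩
    have hp := p.im_pos
    have hmem : (p.re, p.im) ∈ Metric.ball ((x₀, 0) : ℝ × ℝ) r := by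
      rw [Metric.mem_ball, Prod.dist_eq, max_lt_iff, Real.dist_eq, Real.dist_eq]
      exact ⟨hre, by simpa [abs_of_pos hp] using him⟩
    have h := hball hmem
    simp only [mem_ofPred_eq] at h
    have e₁ : α * hypX y p + β * hypY y p =
        (α * ((p.re - y.re) ^ 2 + p.im ^ 2 - y.im ^ 2) + β * (2 * y.im * (p.re - y.re))) /
          (2 * y.im * p.im) := by
      rw [hypX, hypY]
      field_simp
    rw [e₁, cosh_dist_eq_div, ← mul_div_assoc]
    gcongr
  obtain ⟨r₁, hr₁, hbox₁⟩ := hbox α₁ β₁ hε₁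
  obtain ⟨r₂, hr₂, hbox₂⟩ := hbox α₂ β₂ hε₂
  refine ⟨{p | ε * Real.cosh (dist y p) < α₁ * hypX y p + β₁ * hypY y p ∧
    ε * Real.cosh (dist y p) < α₂ * hypX y p + β₂ * hypY y p}, ?_, ?_, ?_⟩
  · have hcosh : Continuous fun p : ℍ => Real.cosh (dist y p) :=
      Real.continuous_cosh.comp (continuous_const.dist continuous_id)
    rw [Set.ofPred_and]
    exact (isOpen_lt (by fun_prop) (by fun_prop)).inter (isOpen_lt (by fun_prop) (by fun_prop))
  · refine volume_eq_top_of_box (x₀ := x₀) (lt_min hr₁ hr₂) fun p hre him => ?_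
    exact ⟨hbox₁ p (hre.trans_le (min_le_left _ _)) (him.trans_le (min_le_left _ _)),
      hbox₂ p (hre.trans_le (min_le_right _ _)) (him.trans_le (min_le_right _ _))⟩
  · refine ⟨max (-Real.log (ε ^ 2 / (2 * (α₁ ^ 2 + β₁ ^ 2)) / 4))
      (-Real.log (ε ^ 2 / (2 * (α₂ ^ 2 + β₂ ^ 2)) / 4)), fun p hp c hc => ?_⟩
    rw [not_and_or, not_lt, not_lt] at hc
    rcases hc with hc | hc
    · obtain ⟨hA, h⟩ := le_cosh_dist_of_separated hε hp.1 hc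
      have := gromov_of_le_cosh (by positivity) h
      linarith [le_max_left (-Real.log (ε ^ 2 / (2 * (α₁ ^ 2 + β₁ ^ 2)) / 4))
        (-Real.log (ε ^ 2 / (2 * (α₂ ^ 2 + β₂ ^ 2)) / 4))]
    · obtain ⟨hA, h⟩ := le_cosh_dist_of_separated hε hp.2 hc
      have := gromov_of_le_cosh (by positivity) h
      linarith [le_max_right (-Real.log (ε ^ 2 / (2 * (α₁ ^ 2 + β₁ ^ 2)) / 4))
        (-Real.log (ε ^ 2 / (2 * (α₂ ^ 2 + β₂ ^ 2)) / 4))]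

theorem IsTessVertex.smul {Γ : Subgroup SL2R} {D : Set ℍ} {v : ℍ} (hv : IsTessVertex Γ D v)
    (g : Γ) : IsTessVertex Γ D ((g : SL2R) • v) := by
  obtain ⟨a, b, c, hab, hac, hbc, ha, hb, hc⟩ := hv
  refine ⟨g * a, g * b, g * c, ?_, ?_, ?_, ?_, ?_, ?_⟩ <;>
    simp only [Subgroup.coe_mul, mul_smul, ne_eq, smul_left_cancel_iff, smul_mem_smul_set_iff] <;>
    assumption

/-- let `Γ` be a Fuchsian group of finite covolume whose
Dirichlet domain `D` has a finite vertex.  Then for every point `y` and every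
open angular sector at `y` (a connected component of the complement of two
distinct geodesics through `y`), the sector contains a finite vertex of the
tessellation `ΓD`; equivalently, the directions from `y` to the finite vertices
are dense in the circle of directions at `y`. -/
theorem stmt11 (Γ : Subgroup SL2R) (hΓ : IsFuchsian Γ)
    (x : ℍ) (hx : FreeCenter Γ x)
    (hvol : hypArea (DirichletDomain Γ x) < ⊤)
    (hvert : ∃ v ∈ DirichletDomain Γ x, IsTessVertex Γ (DirichletDomain Γ x) v) :
    ∀ y : ℍ, ∀ γ₁ γ₂ : ℝ → ℍ, IsGeodesicLine γ₁ → IsGeodesicLine γ₂ →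
      y ∈ Set.range γ₁ → y ∈ Set.range γ₂ → Set.range γ₁ ≠ Set.range γ₂ →
      ∀ z : ℍ, z ∉ Set.range γ₁ ∪ Set.range γ₂ →
        ∃ v : ℍ, IsTessVertex Γ (DirichletDomain Γ x) v ∧
          v ∈ connectedComponentIn (Set.range γ₁ ∪ Set.range γ₂)ᶜ z := by
  intro y γ₁ γ₂ hγ₁ hγ₂ hy₁ hy₂ _ z hz
  rw [mem_union, not_or] at hz
  obtain ⟨α₁, β₁, hline₁, hz₁⟩ := hγ₁.exists_linear_pos hy₁ hz.1
  obtain ⟨α₂, β₂, hline₂, hz₂⟩ := hγ₂.exists_linear_pos hy₂ hz.2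
  set S : Set ℍ := {p : ℍ | 0 < α₁ * hypX y p + β₁ * hypY y p ∧
    0 < α₂ * hypX y p + β₂ * hypY y p}
  have hS : S ⊆ connectedComponentIn (Set.range γ₁ ∪ Set.range γ₂)ᶜ z := by
    refine (isPreconnected_sector y α₁ β₁ α₂ β₂).subset_connectedComponentIn ⟨hz₁, hz₂⟩ ?_
    rintro p ⟨hp₁, hp₂⟩ (hp | hp)
    · exact hp₁.ne' (hline₁ p hp)
    · exact hp₂.ne' (hline₂ p hp)
  obtain ⟨v, -, hv⟩ := hvert
  by_contra! hcon
  have hout (γ : Γ) : (γ : SL2R) • v ∉ S := fun h => hcon _ (hv.smul γ) (hS h)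
  obtain ⟨U, hU, hUtop, K, hK⟩ := exists_infinite_area_subset y hz₁ hz₂
  rw [hypArea_eq_volume] at hvol
  refine (hΓ.volume_lt_top_of_finite hvol hU ?_).ne hUtop
  refine hΓ.finite_of_gromov (v := v) (K := K + 2 * dist y v) fun p hp γ => ?_
  have h := hK p hp _ (hout γ)
  have h₁ := dist_triangle p y v
  have h₂ := dist_triangle v y ((γ : SL2R) • v)
  rw [dist_comm p y] at h₁
  rw [dist_comm v y] at h₂
  linarith
end
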